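/- (Main Theorem, part (a): parametrization of the hysteresis loop.) Let u be a bimodal input, ψ_u its normalized input, σ₀ > 0, g₀ > 0, a = σ₀/g₀. Let y∘ : [0,ϱ₄] → ℝ be defined by y∘(ϱ) = e^{−aϱ} ( y∘(0) + σ₀ ∫₀^ϱ e^{aτ} ψ̇_u(τ) dτ ) with y∘(0) = g₀ e^{−aϱ₄}/(1 − e^{−aϱ₄}) ( 2e^{aϱ₁} − 2e^{aϱ₂} + 2e^{aϱ₃} − e^{aϱ₄} − 1 ), and let y∘_u : [0,t₄] → ℝ be defined by y∘_u(t) = y∘(ρ_u(t)). Then the hysteresis loop { (u(t), y∘_u(t)) : t ∈ [0,t₄] } ⊆ ℝ² equals the set { (ψ_u(ϱ), y∘(ϱ)) : ϱ ∈ [0,ϱ₄] }. -/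

import Mathlib

open MeasureTheory Set

/-- A *bimodal input*: an absolutely continuous function `u : [0,∞) → ℝ`
(represented by `u` together with its a.e.-derivative `du` via the fundamental
theorem of calculus), with essentially bounded derivative, `t4`-periodic,
strictly increasing on `[0,t1]`, strictly decreasing on `[t1,t2]`, strictly
increasing on `[t2,t3]`, strictly decreasing on `[t3,t4]`, taking the
prescribed values at `0, t1, t2, t3, t4`. -/
structure BimodalInput (umin1 umin2 umax1 umax2 t1 t2 t3 t4 : ℝ) where
  u : ℝ → ℝ
  du : ℝ → ℝ
  meas_du : Measurable du
  bdd_du : ∃ C : ℝ, ∀ᵐ τ ∂(volume.restrict (Ici (0:ℝ))), |du τ| ≤ C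
  ftc : ∀ s t : ℝ, 0 ≤ s → s ≤ t → u t - u s = ∫ τ in s..t, du τ
  periodic : ∀ t : ℝ, 0 ≤ t → u (t + t4) = u t
  mono1 : StrictMonoOn u (Icc 0 t1)
  anti1 : StrictAntiOn u (Icc t1 t2)
  mono2 : StrictMonoOn u (Icc t2 t3)
  anti2 : StrictAntiOn u (Icc t3 t4)
  val0 : u 0 = umin1
  val1 : u t1 = umax1
  val2 : u t2 = umin2
  val3 : u t3 = umax2
  val4 : u t4 = umin1

/-- The variation function `ρ_u(t) = ∫₀ᵗ |u̇(τ)| dτ`. -/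
noncomputable def variation (du : ℝ → ℝ) (t : ℝ) : ℝ := ∫ τ in (0:ℝ)..t, |du τ|

/-- The normalized input `ψ_u`, a `ϱ4`-periodic piecewise linear function on
`[0,ϱ4]` determined by the data `u_{min,1}, u_{min,2}, u_{max,1}, u_{max,2}`:
`ψ_u(ϱ)=ϱ+u_{min,1}` on `[0,ϱ1]`, `ψ_u(ϱ)=-ϱ+ϱ1+u_{max,1}` on `[ϱ1,ϱ2]`,
`ψ_u(ϱ)=ϱ-ϱ2+u_{min,2}` on `[ϱ2,ϱ3]`, `ψ_u(ϱ)=-ϱ+ϱ3+u_{max,2}` on `[ϱ3,ϱ4]`,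
where `ϱ1 = u_{max,1}-u_{min,1}`, `ϱ2 = ϱ1+u_{max,1}-u_{min,2}`,
`ϱ3 = ϱ2+u_{max,2}-u_{min,2}`, `ϱ4 = ϱ3+u_{max,2}-u_{min,1}`. -/
noncomputable def psi (umin1 umin2 umax1 umax2 : ℝ) : ℝ → ℝ := fun ϱ =>
  if ϱ ≤ umax1 - umin1 then ϱ + umin1
  else if ϱ ≤ (umax1 - umin1) + umax1 - umin2 then -ϱ + (umax1 - umin1) + umax1
  else if ϱ ≤ ((umax1 - umin1) + umax1 - umin2) + umax2 - umin2 then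
    ϱ - ((umax1 - umin1) + umax1 - umin2) + umin2
  else -ϱ + (((umax1 - umin1) + umax1 - umin2) + umax2 - umin2) + umax2

/-- The derivative `ψ̇_u` of the normalized input: `+1` on `(0,ϱ1) ∪ (ϱ2,ϱ3)`
and `-1` on `(ϱ1,ϱ2) ∪ (ϱ3,ϱ4)` (the values at the finitely many breakpoints
are irrelevant). -/
noncomputable def psiDeriv (umin1 umin2 umax1 umax2 : ℝ) : ℝ → ℝ := fun ϱ =>
  if ϱ ≤ umax1 - umin1 then 1
  else if ϱ ≤ (umax1 - umin1) + umax1 - umin2 then -1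
  else if ϱ ≤ ((umax1 - umin1) + umax1 - umin2) + umax2 - umin2 then 1
  else -1

/-- The integral of the absolute value of the a.e.-derivative of a monotone primitive is the
increment of the primitive. -/
theorem integral_abs_eq_sub_of_monotoneOn {F f : ℝ → ℝ} {s t : ℝ} (hst : s ≤ t)
    (hf : IntervalIntegrable f volume s t)
    (hF : ∀ q ∈ Icc s t, F q - F s = ∫ τ in s..q, f τ)
    (hmono : MonotoneOn F (Icc s t)) :
    ∫ τ in s..t, |f τ| = F t - F s := by
  rw [hF t (right_mem_Icc.2 hst)]
  have hne : ∀ᵐ x : ℝ, x ≠ t := by simp [ae_iff, measure_singleton]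
  apply intervalIntegral.integral_congr_ae
  filter_upwards [hf.ae_hasDerivAt_integral, hne] with x hx hxt hxst
  rw [uIoc_of_le hst] at hxst
  have hmem : x ∈ Icc s t := Ioc_subset_Icc_self hxst
  have hnhds : Icc s t ∈ nhds x := Icc_mem_nhds hxst.1 (lt_of_le_of_ne hxst.2 hxt)
  rw [uIcc_of_le hst] at hx
  have hd : HasDerivAt (fun q => ∫ τ in s..q, f τ) (f x) x :=
    hx hmem s (left_mem_Icc.2 hst)
  have hmono' : MonotoneOn (fun q => ∫ τ in s..q, f τ) (Icc s t) := by
    intro p hp q hq hpq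
    have := hmono hp hq hpq
    simp only [← hF p hp, ← hF q hq]
    linarith
  refine abs_of_nonneg (hd.hasDerivWithinAt.nonneg_of_monotoneOn ?_ hmono')
  exact accPt_iff_frequently_nhdsNE.2
    ((Filter.Eventually.filter_mono nhdsWithin_le_nhds hnhds).frequently)

/-- The antitone counterpart of `integral_abs_eq_sub_of_monotoneOn`. -/
theorem integral_abs_eq_sub_of_antitoneOn {F f : ℝ → ℝ} {s t : ℝ} (hst : s ≤ t)
    (hf : IntervalIntegrable f volume s t)
    (hF : ∀ q ∈ Icc s t, F q - F s = ∫ τ in s..q, f τ)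
    (hanti : AntitoneOn F (Icc s t)) :
    ∫ τ in s..t, |f τ| = F s - F t := by
  have h := integral_abs_eq_sub_of_monotoneOn (F := fun x => -F x) (f := fun x => -f x) hst hf.neg
    (fun q hq => by
      rw [intervalIntegral.integral_neg, ← hF q hq]
      ring) hanti.neg
  simp only [abs_neg] at h
  linarith

namespace BimodalInput

variable {umin1 umin2 umax1 umax2 t1 t2 t3 t4 : ℝ}

theorem intervalIntegrable_du (B : BimodalInput umin1 umin2 umax1 umax2 t1 t2 t3 t4)
    {s t : ℝ} (hs : 0 ≤ s) (hst : s ≤ t) : IntervalIntegrable B.du volume s t := by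
  obtain ⟨C, hC⟩ := B.bdd_du
  rw [intervalIntegrable_iff_integrableOn_Ioc_of_le hst]
  refine IntegrableOn.of_bound measure_Ioc_lt_top B.meas_du.aestronglyMeasurable C ?_
  exact ae_mono (Measure.restrict_mono (fun x hx => hs.trans hx.1.le) le_rfl) hC

theorem variation_eq_add (B : BimodalInput umin1 umin2 umax1 umax2 t1 t2 t3 t4)
    {s t : ℝ} (hs : 0 ≤ s) (hst : s ≤ t) :
    variation B.du t = variation B.du s + ∫ τ in s..t, |B.du τ| :=
  (intervalIntegral.integral_add_adjacent_intervals
    (B.intervalIntegrable_du le_rfl hs).abs (B.intervalIntegrable_du hs hst).abs).symm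

theorem variation_of_monotoneOn (B : BimodalInput umin1 umin2 umax1 umax2 t1 t2 t3 t4)
    {s r t : ℝ} (hs : 0 ≤ s) (hmono : MonotoneOn B.u (Icc s r)) (ht : t ∈ Icc s r) :
    variation B.du t = variation B.du s + (B.u t - B.u s) := by
  rw [B.variation_eq_add hs ht.1, integral_abs_eq_sub_of_monotoneOn ht.1
    (B.intervalIntegrable_du hs ht.1) (fun q hq => B.ftc s q hs hq.1)
    (hmono.mono (Icc_subset_Icc_right ht.2))]

theorem variation_of_antitoneOn (B : BimodalInput umin1 umin2 umax1 umax2 t1 t2 t3 t4)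
    {s r t : ℝ} (hs : 0 ≤ s) (hanti : AntitoneOn B.u (Icc s r)) (ht : t ∈ Icc s r) :
    variation B.du t = variation B.du s + (B.u s - B.u t) := by
  rw [B.variation_eq_add hs ht.1, integral_abs_eq_sub_of_antitoneOn ht.1
    (B.intervalIntegrable_du hs ht.1) (fun q hq => B.ftc s q hs hq.1)
    (hanti.mono (Icc_subset_Icc_right ht.2))]

theorem continuousOn_variation (B : BimodalInput umin1 umin2 umax1 umax2 t1 t2 t3 t4)
    {t : ℝ} (ht : 0 ≤ t) : ContinuousOn (variation B.du) (Icc 0 t) := by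
  have h := intervalIntegral.continuousOn_primitive_interval'
    (B.intervalIntegrable_du le_rfl ht).abs left_mem_uIcc
  rwa [uIcc_of_le ht] at h

theorem monotoneOn_variation (B : BimodalInput umin1 umin2 umax1 umax2 t1 t2 t3 t4) :
    MonotoneOn (variation B.du) (Ici 0) := by
  intro s hs t _ hst
  rw [B.variation_eq_add hs hst]
  exact le_add_of_nonneg_right
    (intervalIntegral.integral_nonneg_of_forall hst fun _ => abs_nonneg _)

section Breakpoints

variable (B : BimodalInput umin1 umin2 umax1 umax2 t1 t2 t3 t4)

theorem variation_of_mem_first {t : ℝ} (ht : t ∈ Icc 0 t1) :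
    variation B.du t = B.u t - umin1 := by
  rw [B.variation_of_monotoneOn le_rfl B.mono1.monotoneOn ht, B.val0]
  simp [variation]

theorem variation_of_mem_second (ht1 : 0 < t1) {t : ℝ} (ht : t ∈ Icc t1 t2) :
    variation B.du t = (umax1 - umin1) + umax1 - B.u t := by
  rw [B.variation_of_antitoneOn ht1.le B.anti1.antitoneOn ht,
    B.variation_of_mem_first (right_mem_Icc.2 ht1.le), B.val1]
  ring

theorem variation_of_mem_third (ht1 : 0 < t1) (ht12 : t1 < t2) {t : ℝ} (ht : t ∈ Icc t2 t3) :
    variation B.du t = ((umax1 - umin1) + umax1 - umin2) + B.u t - umin2 := by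
  rw [B.variation_of_monotoneOn (ht1.trans ht12).le B.mono2.monotoneOn ht,
    B.variation_of_mem_second ht1 (right_mem_Icc.2 ht12.le), B.val2]
  ring

theorem variation_of_mem_fourth (ht1 : 0 < t1) (ht12 : t1 < t2) (ht23 : t2 < t3) {t : ℝ}
    (ht : t ∈ Icc t3 t4) :
    variation B.du t =
      (((umax1 - umin1) + umax1 - umin2) + umax2 - umin2) + umax2 - B.u t := by
  rw [B.variation_of_antitoneOn (ht1.trans (ht12.trans ht23)).le B.anti2.antitoneOn ht,
    B.variation_of_mem_third ht1 ht12 (right_mem_Icc.2 ht23.le), B.val3]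
  ring

/-- The input factors through its variation function as the normalized input. -/
theorem psi_variation (ht1 : 0 < t1) (ht12 : t1 < t2) (ht23 : t2 < t3) (ht34 : t3 < t4)
    {t : ℝ} (ht : t ∈ Icc 0 t4) :
    psi umin1 umin2 umax1 umax2 (variation B.du t) = B.u t := by
  have h0 := B.val0
  have h1 := B.val1
  have h2 := B.val2
  have h3 := B.val3
  have h12 := B.anti1 (left_mem_Icc.2 ht12.le) (right_mem_Icc.2 ht12.le) ht12
  have h23 := B.mono2 (left_mem_Icc.2 ht23.le) (right_mem_Icc.2 ht23.le) ht23
  unfold psi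
  rcases le_total t t1 with hle1 | hge1
  · have hmem : t ∈ Icc 0 t1 := ⟨ht.1, hle1⟩
    have hle := B.mono1.monotoneOn hmem (right_mem_Icc.2 ht1.le) hle1
    rw [B.variation_of_mem_first hmem]
    split_ifs <;> linarith
  rcases le_total t t2 with hle2 | hge2
  · have hmem : t ∈ Icc t1 t2 := ⟨hge1, hle2⟩
    have hle := B.anti1.antitoneOn (left_mem_Icc.2 ht12.le) hmem hge1
    have hge := B.anti1.antitoneOn hmem (right_mem_Icc.2 ht12.le) hle2
    rw [B.variation_of_mem_second ht1 hmem]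
    split_ifs <;> linarith
  rcases le_total t t3 with hle3 | hge3
  · have hmem : t ∈ Icc t2 t3 := ⟨hge2, hle3⟩
    have hle := B.mono2.monotoneOn (left_mem_Icc.2 ht23.le) hmem hge2
    have hge := B.mono2.monotoneOn hmem (right_mem_Icc.2 ht23.le) hle3
    rw [B.variation_of_mem_third ht1 ht12 hmem]
    split_ifs <;> linarith
  · have hmem : t ∈ Icc t3 t4 := ⟨hge3, ht.2⟩
    have hle := B.anti2.antitoneOn (left_mem_Icc.2 ht34.le) hmem hge3
    rw [B.variation_of_mem_fourth ht1 ht12 ht23 hmem]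
    split_ifs <;> linarith

end Breakpoints

/-- The variation function maps `[0,t]` onto `[0,ρ_u(t)]`. -/
theorem image_variation_Icc (B : BimodalInput umin1 umin2 umax1 umax2 t1 t2 t3 t4)
    {t : ℝ} (ht : 0 ≤ t) : variation B.du '' Icc 0 t = Icc 0 (variation B.du t) := by
  have hzero : variation B.du 0 = 0 := by simp [variation]
  apply Subset.antisymm
  · rintro _ ⟨s, hs, rfl⟩
    exact ⟨hzero ▸ B.monotoneOn_variation self_mem_Ici hs.1 hs.1,
      B.monotoneOn_variation hs.1 ht hs.2⟩
  · have h := intermediate_value_Icc ht (B.continuousOn_variation ht)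
    rwa [hzero] at h

end BimodalInput

/-- Main Theorem, part (a): the hysteresis loop
`{(u(t), y∘_u(t)) : t ∈ [0,t4]}` equals `{(ψ_u(ϱ), y∘(ϱ)) : ϱ ∈ [0,ϱ4]}`,
where `y∘_u = y∘ ∘ ρ_u` and `y∘` is the explicit steady-state output for the
normalized input with the periodic initial value `y∘(0)`. -/
theorem lugre_hysteresis_loop_parametrization
    (umin1 umin2 umax1 umax2 t1 t2 t3 t4 : ℝ)
    (hu12 : umin1 ≤ umin2) (hu2M1 : umin2 < umax1) (hM12 : umax1 ≤ umax2)
    (hne : umin1 ≠ umin2 ∨ umax1 ≠ umax2)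
    (ht1 : 0 < t1) (ht12 : t1 < t2) (ht23 : t2 < t3) (ht34 : t3 < t4)
    (B : BimodalInput umin1 umin2 umax1 umax2 t1 t2 t3 t4)
    (σ0 g0 : ℝ) (hσ0 : 0 < σ0) (hg0 : 0 < g0)
    (a : ℝ) (ha : a = σ0 / g0)
    (ϱ1 ϱ2 ϱ3 ϱ4 : ℝ)
    (hϱ1 : ϱ1 = umax1 - umin1)
    (hϱ2 : ϱ2 = ϱ1 + umax1 - umin2)
    (hϱ3 : ϱ3 = ϱ2 + umax2 - umin2)
    (hϱ4 : ϱ4 = ϱ3 + umax2 - umin1)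
    (y0 : ℝ)
    (hy0 : y0 = g0 * (Real.exp (-(a * ϱ4)) / (1 - Real.exp (-(a * ϱ4)))) *
      (2 * Real.exp (a * ϱ1) - 2 * Real.exp (a * ϱ2) + 2 * Real.exp (a * ϱ3)
        - Real.exp (a * ϱ4) - 1))
    (Y : ℝ → ℝ)
    (hY : ∀ ϱ : ℝ, Y ϱ = Real.exp (-(a * ϱ)) *
      (y0 + σ0 * ∫ τ in (0:ℝ)..ϱ, Real.exp (a * τ) * psiDeriv umin1 umin2 umax1 umax2 τ))
    (ycircu : ℝ → ℝ)
    (hyu : ∀ t : ℝ, ycircu t = Y (variation B.du t)) :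
    (fun t => (B.u t, ycircu t)) '' Icc (0:ℝ) t4
      = (fun ϱ => (psi umin1 umin2 umax1 umax2 ϱ, Y ϱ)) '' Icc (0:ℝ) ϱ4 := by
  have ht4 : 0 < t4 := ht1.trans (ht12.trans (ht23.trans ht34))
  have hend : variation B.du t4 = ϱ4 := by
    rw [B.variation_of_mem_fourth ht1 ht12 ht23 (right_mem_Icc.2 ht34.le), B.val4, hϱ4, hϱ3,
      hϱ2, hϱ1]
  rw [← hend, ← B.image_variation_Icc ht4.le, image_image]
  refine image_congr fun t ht => ?_
  rw [hyu, B.psi_variation ht1 ht12 ht23 ht34 ht]
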